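/- arXiv:1306.6775 — 5 statements merged into one kernel-verified Lean document; each statement's English description precedes it below -/
import Mathlib

section
/- (Bowman–Bradley) For all integers n, m ≥ 0, with wt = 4n + 2m, the sum of Z(j_0, j_1, …, j_{2n}) over all tuples of nonnegative integers (j_0, j_1, …, j_{2n}) with j_0 + j_1 + ⋯ + j_{2n} = m equals (1/(2n+1)) · binom(m + 2n, m) · π^{wt} / (wt + 1)!. -/
/-- The multiple zeta value `ζ(s₁, …, s_k) = ∑_{0 < n₁ < ⋯ < n_k} n₁^{-s₁} ⋯ n_k^{-s_k}`,
defined as a `tsum` over strictly increasing tuples of positive integers.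
For the empty tuple this gives `ζ() = 1`. -/
noncomputable def MZV (s : List ℕ) : ℝ :=
  ∑' f : { f : Fin s.length → ℕ+ // StrictMono f },
    ∏ i : Fin s.length, (((f.1 i : ℕ) : ℝ) ^ (s.get i))⁻¹

/-- Given the list `[b₀, b₁, …, b_{2n}]`, produce the argument string
`{2}^{b₀}, 1, {2}^{b₁}, 3, {2}^{b₂}, 1, …, 1, {2}^{b_{2n-1}}, 3, {2}^{b_{2n}}`,
i.e. insert the block `{2}^{b_i}` after the `i`-th entry of `1, 3, 1, 3, …, 1, 3`. -/
def Zargs : List ℕ → List ℕ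
  | [] => []
  | [b0] => List.replicate b0 2
  | b0 :: b1 :: rest =>
      List.replicate b0 2 ++ [1] ++ List.replicate b1 2 ++ [3] ++ Zargs rest

/-- `Z(b₀, …, b_{2n}) = ζ({2}^{b₀}, 1, {2}^{b₁}, 3, …, 1, {2}^{b_{2n-1}}, 3, {2}^{b_{2n}})`. -/
noncomputable def Z (b : List ℕ) : ℝ := MZV (Zargs b)

section

open Finset PowerSeries

/-- The operator on power series `∑ aₙ zⁿ ↦ ∑ n^{-s} (∑_{m < n} aₘ) zⁿ` which adds an outermost
argument `s` to a multiple polylogarithm. -/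
noncomputable def polylogOp (s : ℕ) : ℝ⟦X⟧ →ₗ[ℝ] ℝ⟦X⟧ where
  toFun f := PowerSeries.mk fun n => ((n : ℝ) ^ s)⁻¹ * ∑ m ∈ range n, coeff m f
  map_add' f g := by
    ext n
    simp [sum_add_distrib, mul_add]
  map_smul' r f := by
    ext n
    simp only [coeff_mk, coeff_smul, smul_eq_mul, RingHom.id_apply, ← mul_sum]
    ring

theorem coeff_polylogOp (s n : ℕ) (f : ℝ⟦X⟧) :
    coeff n (polylogOp s f) = ((n : ℝ) ^ s)⁻¹ * ∑ m ∈ range n, coeff m f := by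
  simp [polylogOp]

theorem coeff_zero_polylogOp (s : ℕ) (f : ℝ⟦X⟧) : coeff 0 (polylogOp s f) = 0 := by
  simp [coeff_polylogOp]

/-- The multiple polylogarithm, as a formal power series, whose arguments are listed starting
from the outermost one. -/
noncomputable def polylog (l : List ℕ) : ℝ⟦X⟧ := l.foldr (fun s f => polylogOp s f) 1

theorem polylog_nil : polylog [] = 1 := rfl

theorem polylog_cons (s : ℕ) (l : List ℕ) : polylog (s :: l) = polylogOp s (polylog l) := rfl

theorem coeff_polylogOp_nonneg {f : ℝ⟦X⟧} (hf : ∀ n, 0 ≤ coeff n f) (s n : ℕ) :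
    0 ≤ coeff n (polylogOp s f) := by
  rw [coeff_polylogOp]
  exact mul_nonneg (by positivity) (sum_nonneg fun m _ => hf m)

theorem coeff_polylog_nonneg (l : List ℕ) (n : ℕ) : 0 ≤ coeff n (polylog l) := by
  induction l generalizing n with
  | nil => rw [polylog_nil, coeff_one]; split_ifs <;> simp
  | cons s l ih => exact coeff_polylogOp_nonneg ih s n

/-- The multiple zeta value restricted to indices which exceed `M`, as an extended nonnegative
real. -/
noncomputable def mzvTail (s : List ℕ) (M : ℕ) : ENNReal :=
  ∑' f : Fin s.length → ℕ+, open Classical in if StrictMono f ∧ ∀ i, M < f i then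
    ∏ i, ENNReal.ofReal ((((f i : ℕ) : ℝ) ^ (s.get i))⁻¹) else 0

theorem mzvTail_nil (M : ℕ) : mzvTail [] M = 1 := by
  unfold mzvTail
  have : Unique (Fin ([] : List ℕ).length → ℕ+) := inferInstanceAs (Unique (Fin 0 → ℕ+))
  rw [tsum_eq_single default (fun b hb => absurd (Subsingleton.elim b default) hb)]
  rw [if_pos ⟨fun a => a.elim0, fun a => a.elim0⟩]
  exact Fin.prod_univ_zero _

theorem strictMono_cons_and_lt_iff {k M : ℕ} (a : ℕ+) (f : Fin k → ℕ+) :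
    (StrictMono (Fin.cons a f : Fin (k + 1) → ℕ+) ∧
      ∀ i, M < ((Fin.cons a f : Fin (k + 1) → ℕ+) i : ℕ)) ↔
      M < a ∧ StrictMono f ∧ ∀ i, (a : ℕ) < f i := by
  rw [Fin.forall_fin_succ]
  simp only [Fin.cons_zero, Fin.cons_succ]
  constructor
  · rintro ⟨h, h0, h1⟩
    refine ⟨h0, fun i j hij => ?_, fun i => ?_⟩
    · simpa using h (Fin.succ_lt_succ_iff.2 hij)
    · simpa using h (Fin.succ_pos i)
  · rintro ⟨h0, h, h1⟩
    refine ⟨fun i j => ?_, h0, fun i => h0.trans (h1 i)⟩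
    refine Fin.cases ?_ (fun i => ?_) i <;> refine Fin.cases ?_ (fun j => ?_) j
    · simp
    · intro _
      simpa using h1 j
    · intro hij
      exact absurd hij (by simp)
    · intro hij
      simpa using h (Fin.succ_lt_succ_iff.1 hij)

theorem mzvTail_cons (s : ℕ) (t : List ℕ) (M : ℕ) :
    mzvTail (s :: t) M = ∑' n : ℕ+, if M < (n : ℕ) then
      ENNReal.ofReal ((((n : ℕ) : ℝ) ^ s)⁻¹) * mzvTail t n else 0 := by
  classical
  unfold mzvTail
  refine ((Fin.consEquiv fun _ : Fin (t.length + 1) => ℕ+).tsum_eq _).symm.trans ?_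
  refine ENNReal.tsum_prod'.trans ?_
  refine tsum_congr fun n => ?_
  have key (f : Fin t.length → ℕ+) := strictMono_cons_and_lt_iff (M := M) n f
  split_ifs with hM
  · rw [← ENNReal.tsum_mul_left]
    refine tsum_congr fun f => ?_
    have hk : (StrictMono (Fin.cons n f : Fin (t.length + 1) → ℕ+) ∧
      ∀ i, M < ((Fin.cons n f : Fin (t.length + 1) → ℕ+) i : ℕ)) ↔
      StrictMono f ∧ ∀ i, (n : ℕ) < f i := (key f).trans (by simp [hM])
    by_cases h : StrictMono f ∧ ∀ i, (n : ℕ) < f i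
    · rw [if_pos h]
      refine (if_pos (hk.2 h)).trans ?_
      exact Fin.prod_univ_succ _
    · rw [if_neg h, mul_zero]
      exact if_neg (mt hk.1 h)
  · refine ENNReal.tsum_eq_zero.2 fun f => if_neg fun h => hM ((key f).1 h).1

theorem tsum_eq_tsum_pnat {f : ℕ → ENNReal} (h : f 0 = 0) : ∑' n, f n = ∑' n : ℕ+, f n := by
  rw [tsum_pnat_eq_tsum_succ (f := f), tsum_eq_zero_add' ENNReal.summable, h, zero_add]

theorem tsum_coeff_foldl_polylogOp (s : List ℕ) (f : ℝ⟦X⟧) (hf : ∀ n, 0 ≤ coeff n f) :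
    ∑' n, ENNReal.ofReal (coeff n (s.foldl (fun f a => polylogOp a f) f)) =
      ∑' M, ENNReal.ofReal (coeff M f) * mzvTail s M := by
  induction s generalizing f with
  | nil => simp [mzvTail_nil]
  | cons a t ih =>
    rw [List.foldl_cons, ih _ (coeff_polylogOp_nonneg hf a)]
    rw [tsum_eq_tsum_pnat (by simp [coeff_zero_polylogOp])]
    simp_rw [mzvTail_cons, ← ENNReal.tsum_mul_left]
    rw [ENNReal.tsum_comm]
    refine tsum_congr fun n => ?_
    rw [coeff_polylogOp, ENNReal.ofReal_mul (by positivity),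
      ENNReal.ofReal_sum_of_nonneg fun m _ => hf m, mul_assoc, mul_left_comm, sum_mul]
    rw [tsum_eq_sum (s := range n) fun m hm => by
      rw [if_neg (by simpa using hm), mul_zero]]
    refine sum_congr rfl fun m hm => ?_
    rw [if_pos (by simpa using hm)]

theorem MZV_eq_toReal_mzvTail (s : List ℕ) : MZV s = (mzvTail s 0).toReal := by
  classical
  have h : mzvTail s 0 = ∑' f : { f : Fin s.length → ℕ+ // StrictMono f },
      ENNReal.ofReal (∏ i, (((f.1 i : ℕ) : ℝ) ^ (s.get i))⁻¹) := by
    rw [mzvTail, ← tsum_subtype_eq_of_support_subset (s := {f | StrictMono f})]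
    · refine tsum_congr fun f => ?_
      rw [if_pos ⟨f.2, fun i => (f.1 i).pos⟩,
        ENNReal.ofReal_prod_of_nonneg fun i _ => by positivity]
    · intro f hf
      by_contra h
      exact hf (if_neg fun h' => h h'.1)
  rw [h, ENNReal.tsum_toReal_eq fun _ => ENNReal.ofReal_ne_top, MZV]
  refine tsum_congr fun f => ?_
  rw [ENNReal.toReal_ofReal]
  exact prod_nonneg fun i _ => by positivity

theorem MZV_reverse_eq_tsum_coeff_polylog (l : List ℕ) :
    MZV l.reverse = ∑' n, coeff n (polylog l) := by
  have h := tsum_coeff_foldl_polylogOp l.reverse 1 fun n => by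
    rw [coeff_one]; split_ifs <;> simp
  rw [List.foldl_reverse,
    tsum_eq_single (β := ℕ) (f := fun M => ENNReal.ofReal (coeff M (1 : ℝ⟦X⟧)) * _) 0
    fun M hM => by simp [coeff_one, hM]] at h
  rw [coeff_one, if_pos rfl, ENNReal.ofReal_one, one_mul] at h
  rw [MZV_eq_toReal_mzvTail, ← h, ENNReal.tsum_toReal_eq fun _ => ENNReal.ofReal_ne_top]
  exact tsum_congr fun n => ENNReal.toReal_ofReal (coeff_polylog_nonneg l n)

/-- The argument string `Zargs b` for `b` of odd length, read from the outermost argument: the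
`k`-th inserted entry, counted from the end, is `3` for even `k` and `1` for odd `k`. -/
def outerArgs : List ℕ → List ℕ
  | [] => []
  | [b] => List.replicate b 2
  | b :: c :: r =>
      List.replicate b 2 ++ (if Even (r.length + 1) then 3 else 1) :: outerArgs (c :: r)

theorem outerArgs_append {l : List ℕ} (hl : l ≠ []) (x y : ℕ) :
    outerArgs (l ++ [x, y]) =
      outerArgs l ++ 3 :: (List.replicate x 2 ++ 1 :: List.replicate y 2) := by
  induction l with
  | nil => exact absurd rfl hl
  | cons b l ih =>
    cases l with
    | nil => simp [outerArgs]
    | cons c r =>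
      have h := ih (by simp)
      simp only [List.cons_append] at h ⊢
      rw [outerArgs, h, outerArgs]
      simp [Nat.even_add_one]

theorem reverse_Zargs (b : List ℕ) (hb : Odd b.length) :
    (Zargs b).reverse = outerArgs b.reverse := by
  induction b using Zargs.induct with
  | case1 => simp at hb
  | case2 b => simp [Zargs, outerArgs]
  | case3 b c r ih =>
    have hr : Odd r.length := by
      simpa [Nat.odd_add_one] using hb
    have hr' : r.reverse ≠ [] := by
      rintro h
      simp_all
    have : (b :: c :: r).reverse = r.reverse ++ [c, b] := by simp
    rw [this, outerArgs_append hr', ← ih hr, Zargs]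
    simp

/-- The sum of the multiple polylogarithms attached to `outerArgs j` over all tuples `j` of `k + 1`
nonnegative integers with sum `m`. -/
noncomputable def insertionSum (k m : ℕ) : ℝ⟦X⟧ :=
  ∑ j ∈ Nat.antidiagonalTuple (k + 1) m, polylog (outerArgs (List.ofFn j))

theorem sum_antidiagonalTuple_succ {M : Type*} [AddCommMonoid M] (k m : ℕ)
    (F : (Fin (k + 1) → ℕ) → M) :
    ∑ j ∈ Nat.antidiagonalTuple (k + 1) m, F j =
      ∑ p ∈ antidiagonal m, ∑ j ∈ Nat.antidiagonalTuple k p.2, F (Fin.cons p.1 j) := by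
  rw [sum_sigma']
  refine sum_bij' (fun j _ => ⟨(j 0, ∑ i, Fin.tail j i), Fin.tail j⟩)
    (fun p _ => Fin.cons p.1.1 p.2) ?_ ?_ ?_ ?_ ?_
  · intro j hj
    rw [Nat.mem_antidiagonalTuple, Fin.sum_univ_succ] at hj
    simp [Nat.mem_antidiagonalTuple, Fin.tail, hj]
  · rintro ⟨⟨a, b⟩, j⟩ h
    simp only [mem_sigma, HasAntidiagonal.mem_antidiagonal, Nat.mem_antidiagonalTuple] at h ⊢
    rw [Fin.sum_cons, h.2, h.1]
  · simp
  · rintro ⟨⟨a, b⟩, j⟩ h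
    simp only [mem_sigma, HasAntidiagonal.mem_antidiagonal, Nat.mem_antidiagonalTuple] at h ⊢
    simp [h.2]
  · simp

theorem insertionSum_zero (m : ℕ) : insertionSum 0 m = polylog (List.replicate m 2) := by
  simp [insertionSum, Nat.antidiagonalTuple_one, outerArgs]

theorem insertionSum_succ (k m : ℕ) :
    insertionSum (k + 1) m = ∑ p ∈ antidiagonal m, ((polylogOp 2)^[p.1])
      (polylogOp (if Even (k + 1) then 3 else 1) (insertionSum k p.2)) := by
  have hrep (a : ℕ) (l : List ℕ) :
      polylog (List.replicate a 2 ++ l) = ((polylogOp 2)^[a]) (polylog l) := by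
    induction a with
    | zero => simp
    | succ a ih =>
      rw [List.replicate_succ, List.cons_append, polylog_cons, ih, Function.iterate_succ_apply']
  rw [insertionSum, sum_antidiagonalTuple_succ]
  refine sum_congr rfl fun p _ => ?_
  rw [insertionSum, map_sum, ← Module.End.coe_pow, map_sum]
  refine sum_congr rfl fun j _ => ?_
  rw [Module.End.coe_pow, ← polylog_cons, ← hrep]
  simp [List.ofFn_succ, outerArgs]

theorem insertionSum_succ_zero (k : ℕ) :
    insertionSum (k + 1) 0 = polylogOp (if Even (k + 1) then 3 else 1) (insertionSum k 0) := by
  simp [insertionSum_succ]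

theorem insertionSum_succ_succ (k m : ℕ) :
    insertionSum (k + 1) (m + 1) = polylogOp 2 (insertionSum (k + 1) m) +
      polylogOp (if Even (k + 1) then 3 else 1) (insertionSum k (m + 1)) := by
  rw [insertionSum_succ, Nat.sum_antidiagonal_succ, insertionSum_succ, map_sum, add_comm]
  congr 1
  exact sum_congr rfl fun p _ => Function.iterate_succ_apply' _ _ _

theorem insertionSum_zero_succ (m : ℕ) :
    insertionSum 0 (m + 1) = polylogOp 2 (insertionSum 0 m) := by
  simp [insertionSum_zero, List.replicate_succ, polylog_cons]

theorem sum_MZV_eq_sum_tsum (n m : ℕ) :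
    ∑ j ∈ Nat.antidiagonalTuple (2 * n + 1) m, Z (List.ofFn j) =
      ∑ j ∈ Nat.antidiagonalTuple (2 * n + 1) m,
        ∑' N, coeff N (polylog (outerArgs (List.ofFn j))) := by
  have hrev (j : Fin (2 * n + 1) → ℕ) : List.ofFn (j ∘ Fin.rev) = (List.ofFn j).reverse := by
    apply List.ext_get
    · simp
    · intro i h1 h2
      simp only [List.get_eq_getElem, List.getElem_ofFn, List.getElem_reverse, List.length_ofFn,
        Function.comp_apply]
      congr 1
      ext
      simp
  refine sum_bij' (fun j _ => j ∘ Fin.rev) (fun j _ => j ∘ Fin.rev) ?_ ?_ ?_ ?_ ?_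
  · intro j hj
    rw [Nat.mem_antidiagonalTuple] at hj ⊢
    rw [← hj]
    exact Equiv.sum_comp Fin.revPerm j
  · intro j hj
    rw [Nat.mem_antidiagonalTuple] at hj ⊢
    rw [← hj]
    exact Equiv.sum_comp Fin.revPerm j
  · intro j _
    ext i
    simp
  · intro j _
    ext i
    simp
  · intro j _
    rw [hrev, ← reverse_Zargs _ (by simp), ← MZV_reverse_eq_tsum_coeff_polylog,
      List.reverse_reverse, Z]

/-- The Euler operator `z d/dz` on formal power series. -/
noncomputable def eulerDerivation : Derivation ℝ ℝ⟦X⟧ ℝ⟦X⟧ := (X : ℝ⟦X⟧) • d⁄dX ℝ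

theorem coeff_eulerDerivation (n : ℕ) (f : ℝ⟦X⟧) :
    coeff n (eulerDerivation f) = n * coeff n f := by
  cases n with
  | zero => simp [eulerDerivation]
  | succ n =>
    simp only [eulerDerivation, Derivation.smul_apply, smul_eq_mul, coeff_succ_X_mul,
      coeff_derivative]
    push_cast
    ring

theorem eq_of_eulerDerivation_eq {f g : ℝ⟦X⟧} (h : eulerDerivation f = eulerDerivation g)
    (h0 : coeff 0 f = coeff 0 g) : f = g := by
  ext n
  have hn := congrArg (coeff n) h
  rw [coeff_eulerDerivation, coeff_eulerDerivation] at hn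
  rcases Nat.eq_zero_or_pos n with rfl | hpos
  · exact h0
  · exact mul_left_cancel₀ (by positivity) hn

/-- The geometric series `z / (1 - z)`. -/
noncomputable def geomSeries : ℝ⟦X⟧ := PowerSeries.mk fun n => if n = 0 then 0 else 1

theorem coeff_geomSeries_mul (n : ℕ) (f : ℝ⟦X⟧) :
    coeff n (geomSeries * f) = ∑ m ∈ range n, coeff m f := by
  rw [mul_comm, coeff_mul, Nat.sum_antidiagonal_eq_sum_range_succ_mk, sum_range_succ]
  simp only [geomSeries, coeff_mk]
  rw [Nat.sub_self, if_pos rfl, mul_zero, add_zero]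
  refine sum_congr rfl fun m hm => ?_
  rw [if_neg (by have := mem_range.1 hm; omega), mul_one]

theorem eulerDerivation_polylogOp_one (f : ℝ⟦X⟧) :
    eulerDerivation (polylogOp 1 f) = geomSeries * f := by
  ext n
  rw [coeff_eulerDerivation, coeff_polylogOp, coeff_geomSeries_mul, pow_one]
  rcases Nat.eq_zero_or_pos n with rfl | hpos
  · simp
  · field_simp

theorem eulerDerivation_polylogOp_succ (s : ℕ) (f : ℝ⟦X⟧) :
    eulerDerivation (polylogOp (s + 2) f) = polylogOp (s + 1) f := by
  ext n
  rw [coeff_eulerDerivation, coeff_polylogOp, coeff_polylogOp]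
  rcases Nat.eq_zero_or_pos n with rfl | hpos
  · simp
  · field_simp
    ring

/-- The homogeneous sum of the insertion sums with `k` insertions of parity `e` and weights `v` for
each inserted entry and `u` for each entry `2`. -/
noncomputable def insertionSeries (u v : ℝ) (e : Prop) [Decidable e] (N : ℕ) : ℝ⟦X⟧ :=
  ∑ x ∈ antidiagonal N, if (Even x.1 ↔ e) then (v ^ x.1 * u ^ x.2) • insertionSum x.1 x.2 else 0

theorem sum_antidiagonal_succ_of_recursion {M : Type*} [AddCommMonoid M] {a P R : ℕ → ℕ → M}
    (h0 : ∀ m, a 0 (m + 1) = P 0 m) (h1 : ∀ k, a (k + 1) 0 = R k 0)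
    (h2 : ∀ k m, a (k + 1) (m + 1) = P (k + 1) m + R k (m + 1)) (N : ℕ) :
    ∑ x ∈ antidiagonal (N + 1), a x.1 x.2 =
      ∑ x ∈ antidiagonal N, P x.1 x.2 + ∑ x ∈ antidiagonal N, R x.1 x.2 := by
  let P' : ℕ → ℕ → M := fun k m => Nat.casesOn m 0 (P k)
  let R' : ℕ → ℕ → M := fun k m => Nat.casesOn k 0 fun k => R k m
  have h : ∑ x ∈ antidiagonal (N + 1), a x.1 x.2 =
      ∑ x ∈ antidiagonal (N + 1), (P' x.1 x.2 + R' x.1 x.2) := by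
    refine sum_congr rfl fun ⟨k, m⟩ hx => ?_
    cases k with
    | zero =>
      cases m with
      | zero => simp at hx
      | succ m => simp [h0, P', R']
    | succ k =>
      cases m with
      | zero => simp [h1, P', R']
      | succ m => simp [h2, P', R']
  rw [h, sum_add_distrib, Nat.sum_antidiagonal_succ', Nat.sum_antidiagonal_succ]
  simp [P', R']

theorem insertionSeries_succ (u v : ℝ) {e e' : Prop} [Decidable e] [Decidable e'] (hee : e' ↔ ¬ e)
    (N : ℕ) :
    insertionSeries u v e (N + 1) = u • polylogOp 2 (insertionSeries u v e N) +
      v • polylogOp (if e then 3 else 1) (insertionSeries u v e' N) := by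
  rw [insertionSeries, insertionSeries, insertionSeries, map_sum, map_sum, smul_sum, smul_sum]
  refine sum_antidiagonal_succ_of_recursion (a := fun k m =>
    if (Even k ↔ e) then (v ^ k * u ^ m) • insertionSum k m else 0) (P := fun k m =>
      u • polylogOp 2 (if (Even k ↔ e) then (v ^ k * u ^ m) • insertionSum k m else 0))
      (R := fun k m => v • polylogOp (if e then 3 else 1)
        (if (Even k ↔ e') then (v ^ k * u ^ m) • insertionSum k m else 0)) ?_ ?_ ?_ N
  · intro m
    simp only [insertionSum_zero_succ]
    split_ifs
    · rw [map_smul, smul_smul]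
      ring_nf
    · simp
  · intro k
    have hk : (Even (k + 1) ↔ e) ↔ (Even k ↔ e') := by rw [Nat.even_add_one, hee]; tauto
    by_cases h : Even (k + 1) ↔ e
    · have he : (if Even (k + 1) then 3 else 1) = if e then 3 else 1 := by simp only [h]
      have hs : v ^ (k + 1) * u ^ 0 = v * (v ^ k * u ^ 0) := by ring
      simp only [if_pos h, if_pos (hk.1 h), map_smul, smul_smul, insertionSum_succ_zero,
        hs, he]
    · simp only [if_neg h, if_neg (mt hk.2 h), map_zero, smul_zero]
  · intro k m
    have hk : (Even (k + 1) ↔ e) ↔ (Even k ↔ e') := by rw [Nat.even_add_one, hee]; tauto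
    by_cases h : Even (k + 1) ↔ e
    · have he : (if Even (k + 1) then 3 else 1) = if e then 3 else 1 := by simp only [h]
      have hs : v ^ (k + 1) * u ^ (m + 1) = v * (v ^ k * u ^ (m + 1)) := by ring
      have hs' : v * (v ^ k * u ^ (m + 1)) = u * (v ^ (k + 1) * u ^ m) := by ring
      simp only [if_pos h, if_pos (hk.1 h), map_smul, smul_smul, insertionSum_succ_succ,
        smul_add, he, hs]
      rw [hs']
    · simp only [if_neg h, if_neg (mt hk.2 h), map_zero, smul_zero, add_zero]

theorem insertionSeries_zero (u v : ℝ) (e : Prop) [Decidable e] :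
    insertionSeries u v e 0 = if e then 1 else 0 := by
  simp [insertionSeries, insertionSum_zero, polylog_nil]

/-- The degree `N` part of the product of the series `∑ p^{2i} xᵢ` and `∑ q^{2j} yⱼ`. -/
noncomputable def weightedConv (p q : ℝ) (x y : ℕ → ℝ⟦X⟧) (N : ℕ) : ℝ⟦X⟧ :=
  ∑ i ∈ antidiagonal N, (p ^ (2 * i.1) * q ^ (2 * i.2)) • (x i.1 * y i.2)

theorem eulerDerivation_weightedConv (p q : ℝ) (x y : ℕ → ℝ⟦X⟧) (N : ℕ) :
    eulerDerivation (weightedConv p q x y N) =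
      weightedConv p q (fun i => eulerDerivation (x i)) y N +
        weightedConv p q x (fun i => eulerDerivation (y i)) N := by
  simp only [weightedConv, map_sum, ← sum_add_distrib]
  refine sum_congr rfl fun i _ => ?_
  rw [Derivation.map_smul, Derivation.leibniz, ← smul_add, smul_eq_mul, smul_eq_mul, add_comm,
    mul_comm (y _)]

/-- The sequence `0, f 0, f 1, …`. -/
def shiftSeq {M : Type*} [Zero M] (f : ℕ → M) : ℕ → M
  | 0 => 0
  | n + 1 => f n

theorem weightedConv_shiftSeq_left (p q : ℝ) (x y : ℕ → ℝ⟦X⟧) (N : ℕ) :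
    weightedConv p q (shiftSeq x) y N = p ^ 2 • shiftSeq (weightedConv p q x y) N := by
  cases N with
  | zero => simp [weightedConv, shiftSeq]
  | succ N =>
    rw [weightedConv, Nat.sum_antidiagonal_succ, shiftSeq]
    simp only [shiftSeq, weightedConv, smul_sum, zero_mul, smul_zero, zero_add, smul_smul]
    refine sum_congr rfl fun i _ => ?_
    congr 1
    ring

theorem weightedConv_shiftSeq_right (p q : ℝ) (x y : ℕ → ℝ⟦X⟧) (N : ℕ) :
    weightedConv p q x (shiftSeq y) N = q ^ 2 • shiftSeq (weightedConv p q x y) N := by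
  cases N with
  | zero => simp [weightedConv, shiftSeq]
  | succ N =>
    rw [weightedConv, Nat.sum_antidiagonal_succ', shiftSeq]
    simp only [shiftSeq, weightedConv, smul_sum, mul_zero, smul_zero, zero_add, smul_smul]
    refine sum_congr rfl fun i _ => ?_
    congr 1
    ring

theorem weightedConv_mul_left (p q : ℝ) (w : ℝ⟦X⟧) (x y : ℕ → ℝ⟦X⟧) (N : ℕ) :
    weightedConv p q (fun i => w * x i) y N = w * weightedConv p q x y N := by
  simp only [weightedConv, mul_sum, mul_smul_comm, mul_assoc]

theorem weightedConv_mul_right (p q : ℝ) (w : ℝ⟦X⟧) (x y : ℕ → ℝ⟦X⟧) (N : ℕ) :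
    weightedConv p q x (fun i => w * y i) N = w * weightedConv p q x y N := by
  simp only [weightedConv, mul_sum, mul_smul_comm, mul_left_comm]

theorem coeff_zero_weightedConv_left (p q : ℝ) {x y : ℕ → ℝ⟦X⟧} (hx : ∀ i, coeff 0 (x i) = 0)
    (N : ℕ) : coeff 0 (weightedConv p q x y N) = 0 := by
  simp only [coeff_zero_eq_constantCoeff] at hx
  simp [weightedConv, hx]

theorem coeff_zero_weightedConv_right (p q : ℝ) {x y : ℕ → ℝ⟦X⟧} (hy : ∀ i, coeff 0 (y i) = 0)
    (N : ℕ) : coeff 0 (weightedConv p q x y N) = 0 := by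
  simp only [coeff_zero_eq_constantCoeff] at hy
  simp [weightedConv, hy]

theorem insertionSeries_eq_weightedConv (p q : ℝ) {g h : ℕ → ℝ⟦X⟧} (hg0 : g 0 = 1)
    (hg : ∀ i, g (i + 1) = polylogOp 2 (g i)) (hh : ∀ i, h i = polylogOp 1 (g i)) (N : ℕ) :
    insertionSeries (p ^ 2 + q ^ 2) (2 * p * q) True N = weightedConv p q g g N ∧
    insertionSeries (p ^ 2 + q ^ 2) (2 * p * q) False N = (p * q) • shiftSeq (fun N =>
      weightedConv p q h g N + weightedConv p q g h N) N := by
  have hθg : (fun i => eulerDerivation (g i)) = shiftSeq h := by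
    funext i
    cases i with
    | zero => simp [hg0, shiftSeq]
    | succ i => rw [hg, eulerDerivation_polylogOp_succ, shiftSeq, hh]
  have hθh : (fun i => eulerDerivation (h i)) = fun i => geomSeries * g i := by
    funext i
    rw [hh, eulerDerivation_polylogOp_one]
  have hh0 (i : ℕ) : coeff 0 (h i) = 0 := by rw [hh, coeff_zero_polylogOp]
  have hθhg (N : ℕ) : eulerDerivation (weightedConv p q h g N) =
      geomSeries * weightedConv p q g g N + q ^ 2 • shiftSeq (weightedConv p q h h) N := by
    rw [eulerDerivation_weightedConv, hθh, hθg, weightedConv_mul_left,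
      weightedConv_shiftSeq_right]
  have hθgh (N : ℕ) : eulerDerivation (weightedConv p q g h N) =
      p ^ 2 • shiftSeq (weightedConv p q h h) N + geomSeries * weightedConv p q g g N := by
    rw [eulerDerivation_weightedConv, hθh, hθg, weightedConv_mul_right,
      weightedConv_shiftSeq_left]
  have hθhh (N : ℕ) : eulerDerivation (weightedConv p q h h N) =
      geomSeries * (weightedConv p q h g N + weightedConv p q g h N) := by
    rw [eulerDerivation_weightedConv, hθh, weightedConv_mul_left, weightedConv_mul_right, mul_add,
      add_comm]
  induction N with
  | zero => simp [insertionSeries_zero, weightedConv, hg0, shiftSeq]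
  | succ N ih =>
    obtain ⟨ihA, ihD⟩ := ih
    have hB : polylogOp 1 (insertionSeries (p ^ 2 + q ^ 2) (2 * p * q) False N) =
        (p * q) • shiftSeq (weightedConv p q h h) N := by
      rw [ihD, map_smul]
      congr 1
      cases N with
      | zero => simp [shiftSeq]
      | succ N =>
        simp only [shiftSeq]
        refine eq_of_eulerDerivation_eq ?_ ?_
        · rw [eulerDerivation_polylogOp_one, hθhh]
        · rw [coeff_zero_polylogOp, coeff_zero_weightedConv_left p q hh0]
    constructor
    · rw [insertionSeries_succ _ _ (e' := False) (by simp), if_pos trivial]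
      refine eq_of_eulerDerivation_eq (eq_of_eulerDerivation_eq ?_ ?_) ?_
      · rw [eulerDerivation_weightedConv, hθg, weightedConv_shiftSeq_left,
          weightedConv_shiftSeq_right, shiftSeq, shiftSeq]
        simp only [map_add, Derivation.map_smul, eulerDerivation_polylogOp_succ,
          eulerDerivation_polylogOp_one, hθhg, hθgh, zero_add, hB, ihA]
        module
      · simp only [coeff_eulerDerivation, Nat.cast_zero, zero_mul]
      · rw [map_add, coeff_smul, coeff_smul, coeff_zero_polylogOp, coeff_zero_polylogOp,
          weightedConv, map_sum, eq_comm]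
        rw [smul_zero, smul_zero, add_zero]
        refine sum_eq_zero fun ⟨i, j⟩ hij => ?_
        have hg' (i : ℕ) : constantCoeff (g (i + 1)) = 0 := by
          rw [hg, ← coeff_zero_eq_constantCoeff_apply, coeff_zero_polylogOp]
        cases i with
        | succ i => simp [hg']
        | zero =>
          cases j with
          | succ j => simp [hg']
          | zero => simp at hij
    · rw [insertionSeries_succ _ _ (e' := True) (by simp), if_neg not_false]
      refine eq_of_eulerDerivation_eq ?_ ?_
      · simp only [shiftSeq, map_add, Derivation.map_smul, eulerDerivation_polylogOp_succ,
          eulerDerivation_polylogOp_one, hθhg, hθgh, zero_add, hB, ihA]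
        module
      · rw [map_add, coeff_smul, coeff_smul, coeff_zero_polylogOp, coeff_zero_polylogOp,
          shiftSeq, coeff_smul, map_add, coeff_zero_weightedConv_left p q hh0,
          coeff_zero_weightedConv_right p q hh0]
        simp

theorem coeff_prod_eq_sum_coeff_polylog (N i : ℕ) :
    (∏ j ∈ range N, (1 + Polynomial.C ((((j : ℝ) + 1) ^ 2)⁻¹) * Polynomial.X)).coeff i =
      ∑ m ∈ range (N + 1), coeff m (polylog (List.replicate i 2)) := by
  induction N generalizing i with
  | zero =>
    cases i with
    | zero => simp [polylog_nil]
    | succ i =>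
      rw [range_zero, prod_empty, sum_range_one, List.replicate_succ, polylog_cons,
        coeff_zero_polylogOp, Polynomial.coeff_one, if_neg (by simp)]
  | succ N ih =>
    rw [prod_range_succ, mul_add, mul_one, Polynomial.coeff_add, ih, sum_range_succ _ (N + 1),
      ← mul_assoc]
    congr 1
    cases i with
    | zero => simp [polylog_nil, coeff_one]
    | succ i =>
      rw [Polynomial.coeff_mul_X, Polynomial.coeff_mul_C, ih, List.replicate_succ, polylog_cons,
        coeff_polylogOp, mul_comm]
      push_cast
      rfl

theorem hasSum_coeff_smul_pow {A : Type*} [CommRing A] [Algebra ℝ A] [TopologicalSpace A]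
    (P : Polynomial ℝ) (x : A) :
    HasSum (fun i => P.coeff i • x ^ i) (Polynomial.aeval x P) := by
  rw [Polynomial.aeval_eq_sum_range]
  refine hasSum_sum_of_ne_finset_zero fun i hi => ?_
  rw [Polynomial.coeff_eq_zero_of_natDegree_lt (by simpa using hi), zero_smul]

theorem hasSum_sum_coeff_polylog {A : Type*} [CommRing A] [Algebra ℝ A] [TopologicalSpace A]
    (N : ℕ) (x : A) :
    HasSum (fun i => (∑ m ∈ range (N + 1), coeff m (polylog (List.replicate i 2))) • x ^ i)
      (∏ j ∈ range N, (1 + (((j : ℝ) + 1) ^ 2)⁻¹ • x)) := by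
  have h := hasSum_coeff_smul_pow
    (∏ j ∈ range N, (1 + Polynomial.C ((((j : ℝ) + 1) ^ 2)⁻¹) * Polynomial.X)) x
  simp only [coeff_prod_eq_sum_coeff_polylog] at h
  simpa [map_prod, Algebra.smul_def] using h

theorem exists_sum_coeff_polylog_replicate_two_le :
    ∃ K : ℝ, ∀ N i, ∑ m ∈ range (N + 1), coeff m (polylog (List.replicate i 2)) ≤
      K * (2⁻¹ : ℝ) ^ i := by
  have hs : Summable fun j : ℕ => (((j : ℝ) + 1) ^ 2)⁻¹ * 2 := by
    refine Summable.mul_right _ ?_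
    have h := (summable_nat_add_iff 1).2 (Real.summable_nat_pow_inv.2 one_lt_two)
    simpa using h
  refine ⟨Real.exp (∑' j : ℕ, (((j : ℝ) + 1) ^ 2)⁻¹ * 2), fun N i => ?_⟩
  have h := hasSum_sum_coeff_polylog N (2 : ℝ)
  have h1 := le_hasSum h i fun j _ => smul_nonneg
    (sum_nonneg fun m _ => coeff_polylog_nonneg _ m) (by positivity)
  have h2 : ∏ j ∈ range N, (1 + (((j : ℝ) + 1) ^ 2)⁻¹ • (2 : ℝ)) ≤
      Real.exp (∑' j : ℕ, (((j : ℝ) + 1) ^ 2)⁻¹ * 2) := by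
    calc ∏ j ∈ range N, (1 + (((j : ℝ) + 1) ^ 2)⁻¹ • (2 : ℝ))
        ≤ ∏ j ∈ range N, Real.exp ((((j : ℝ) + 1) ^ 2)⁻¹ * 2) := by
          refine prod_le_prod (fun j _ => by positivity) fun j _ => ?_
          rw [smul_eq_mul, add_comm]
          exact Real.add_one_le_exp _
      _ = Real.exp (∑ j ∈ range N, (((j : ℝ) + 1) ^ 2)⁻¹ * 2) := (Real.exp_sum _ _).symm
      _ ≤ _ := Real.exp_le_exp.2 (hs.sum_le_tsum _ fun j _ => by positivity)
  rw [inv_pow, ← div_eq_mul_inv, le_div_iff₀ (by positivity)]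
  exact h1.trans h2

theorem summable_coeff_polylog_replicate_two (i : ℕ) :
    Summable fun n => coeff n (polylog (List.replicate i 2)) := by
  obtain ⟨K, hK⟩ := exists_sum_coeff_polylog_replicate_two_le
  refine summable_of_sum_range_le (coeff_polylog_nonneg _) fun N => le_trans ?_ (hK N i)
  exact sum_le_sum_of_subset_of_nonneg (range_mono N.le_succ)
    fun n _ _ => coeff_polylog_nonneg _ n

theorem tendsto_sum_coeff_polylog_replicate_two (i : ℕ) :
    Filter.Tendsto (fun N => ∑ m ∈ range (N + 1), coeff m (polylog (List.replicate i 2)))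
      Filter.atTop (nhds (∑' n, coeff n (polylog (List.replicate i 2)))) :=
  (summable_coeff_polylog_replicate_two i).hasSum.tendsto_sum_nat.comp
    (Filter.tendsto_add_atTop_nat 1)

theorem hasSum_tsum_coeff_polylog_smul_pow {z : ℂ} (hz : z ≠ 0) (hz1 : ‖z‖ ≤ 1) :
    HasSum (fun i => (∑' n, coeff n (polylog (List.replicate i 2))) • (-z ^ 2) ^ i)
      (Complex.sin (Real.pi * z) / (Real.pi * z)) := by
  obtain ⟨K, hK⟩ := exists_sum_coeff_polylog_replicate_two_le
  have hx : ‖-z ^ 2‖ ≤ 1 := by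
    rw [norm_neg, norm_pow]
    exact pow_le_one₀ (norm_nonneg z) hz1
  have hbs : Summable fun i : ℕ => K * (2⁻¹ : ℝ) ^ i :=
    (summable_geometric_of_lt_one (by norm_num) (by norm_num)).mul_left K
  have hb (i : ℕ) (a : ℝ) (ha : 0 ≤ a) (ha' : a ≤ K * (2⁻¹ : ℝ) ^ i) :
      ‖a • (-z ^ 2) ^ i‖ ≤ K * (2⁻¹ : ℝ) ^ i := by
    rw [norm_smul, norm_pow, Real.norm_of_nonneg ha]
    exact (mul_le_of_le_one_right ha (pow_le_one₀ (norm_nonneg _) hx)).trans ha'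
  have hsum : Summable fun i =>
      (∑' n, coeff n (polylog (List.replicate i 2))) • (-z ^ 2) ^ i := by
    refine Summable.of_norm_bounded hbs fun i =>
      hb i _ (tsum_nonneg (coeff_polylog_nonneg _)) ?_
    exact le_of_tendsto' (tendsto_sum_coeff_polylog_replicate_two i) fun N => hK N i
  have hlim := tendsto_tsum_of_dominated_convergence (𝓕 := Filter.atTop) hbs
    (fun i => (tendsto_sum_coeff_polylog_replicate_two i).smul_const ((-z ^ 2) ^ i))
    (Filter.Eventually.of_forall fun N i =>
      hb i _ (sum_nonneg fun m _ => coeff_polylog_nonneg _ m) (hK N i))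
  simp only [(hasSum_sum_coeff_polylog _ (-z ^ 2)).tsum_eq] at hlim
  have hpi : (Real.pi : ℂ) * z ≠ 0 := mul_ne_zero (by exact_mod_cast Real.pi_ne_zero) hz
  have hsin := tendsto_nhds_unique (hlim.const_mul ((Real.pi : ℂ) * z))
    ((Complex.tendsto_euler_sin_prod z).congr fun N => by
      congr 1
      refine prod_congr rfl fun j _ => ?_
      rw [Complex.real_smul]
      push_cast
      ring)
  rw [← hsin, mul_div_cancel_left₀ _ hpi]
  exact hsum.hasSum

theorem tsum_coeff_polylog_replicate_two (i : ℕ) :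
    ∑' n, coeff n (polylog (List.replicate i 2)) =
      Real.pi ^ (2 * i) / ((2 * i + 1).factorial : ℝ) := by
  set e : ℕ → ℝ := fun i => ∑' n, coeff n (polylog (List.replicate i 2)) with he
  set c : ℕ → ℝ := fun i => Real.pi ^ (2 * i) / ((2 * i + 1).factorial : ℝ) with hc
  have h0 : e 0 = c 0 := by
    simp only [he, hc, List.replicate_zero, polylog_nil, coeff_one]
    simp
  have hsum (x : ℂ) (hx : ‖x‖ ≤ 1) : HasSum (fun n => x ^ n • ((e n - c n : ℝ) : ℂ)) 0 := by
    rcases eq_or_ne x 0 with rfl | hx0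
    · convert hasSum_zero with n
      rcases eq_or_ne n 0 with rfl | hn
      · simp [h0]
      · simp [hn]
    · obtain ⟨z, hz⟩ : ∃ z : ℂ, z ^ 2 = -x := IsAlgClosed.exists_pow_nat_eq (-x) two_pos
      have hz0 : z ≠ 0 := by
        rintro rfl
        simp_all
      have hz1 : ‖z‖ ≤ 1 := by
        rw [← norm_neg, ← hz, norm_pow] at hx
        exact (pow_le_one_iff_of_nonneg (norm_nonneg z) two_ne_zero).1 hx
      have h1 : HasSum (fun i => e i • (-z ^ 2) ^ i) _ := hasSum_tsum_coeff_polylog_smul_pow hz0 hz1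
      have hpi : (Real.pi : ℂ) ≠ 0 := by exact_mod_cast Real.pi_ne_zero
      have h2 := (Complex.hasSum_sin (Real.pi * z)).div_const (Real.pi * z)
      have h3 := h1.sub h2
      rw [sub_self] at h3
      have hxz : x = -z ^ 2 := by rw [hz, neg_neg]
      refine (congrArg (fun f : ℕ → ℂ => HasSum f 0) (funext fun n => ?_)).mpr h3
      have hfac : ((2 * n + 1).factorial : ℂ) ≠ 0 := by exact_mod_cast Nat.factorial_ne_zero _
      simp only [hc, hxz, smul_eq_mul, Complex.real_smul]
      push_cast
      rw [mul_sub, mul_comm]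
      congr 1
      rw [neg_pow (z ^ 2)]
      field_simp
      ring
  have hps : HasFPowerSeriesAt (fun _ : ℂ => (0 : ℂ))
      (FormalMultilinearSeries.ofScalars ℂ fun n => ((e n - c n : ℝ) : ℂ)) 0 := by
    rw [hasFPowerSeriesAt_iff]
    filter_upwards [Metric.closedBall_mem_nhds (0 : ℂ) one_pos] with x hx
    simpa [FormalMultilinearSeries.coeff_ofScalars] using hsum x (by simpa using hx)
  have hi : (FormalMultilinearSeries.ofScalars ℂ fun n => ((e n - c n : ℝ) : ℂ)).coeff i = 0 := by
    rw [hps.eq_zero]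
    rfl
  rw [FormalMultilinearSeries.coeff_ofScalars] at hi
  exact sub_eq_zero.1 (by exact_mod_cast hi)

theorem coeff_insertionSum_nonneg (k m n : ℕ) : 0 ≤ coeff n (insertionSum k m) := by
  rw [insertionSum, map_sum]
  exact sum_nonneg fun j _ => coeff_polylog_nonneg _ n

theorem hasSum_coeff_mul {f g : ℝ⟦X⟧} (hf : Summable fun n => coeff n f)
    (hg : Summable fun n => coeff n g) :
    HasSum (fun n => coeff n (f * g)) ((∑' n, coeff n f) * ∑' n, coeff n g) := by
  rw [tsum_mul_tsum_eq_tsum_sum_antidiagonal_of_summable_norm hf.norm hg.norm]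
  simp only [coeff_mul]
  exact (summable_norm_sum_mul_antidiagonal_of_summable_norm hf.norm hg.norm).of_norm.hasSum

theorem hasSum_coeff_weightedConv (p q : ℝ) {x y : ℕ → ℝ⟦X⟧}
    (hx : ∀ i, Summable fun n => coeff n (x i)) (hy : ∀ i, Summable fun n => coeff n (y i))
    (N : ℕ) :
    HasSum (fun n => coeff n (weightedConv p q x y N)) (∑ i ∈ antidiagonal N,
      (p ^ (2 * i.1) * q ^ (2 * i.2)) * ((∑' n, coeff n (x i.1)) * ∑' n, coeff n (y i.2))) := by
  simp only [weightedConv, map_sum, coeff_smul, smul_eq_mul]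
  exact hasSum_sum fun i _ => (hasSum_coeff_mul (hx i.1) (hy i.2)).mul_left _

theorem insertionSeries_true_eq_weightedConv (p q : ℝ) (N : ℕ) :
    insertionSeries (p ^ 2 + q ^ 2) (2 * p * q) True N =
      weightedConv p q (fun i => polylog (List.replicate i 2))
        (fun i => polylog (List.replicate i 2)) N :=
  (insertionSeries_eq_weightedConv p q polylog_nil (fun _ => rfl) (fun _ => rfl) N).1

theorem summable_coeff_insertionSum {k : ℕ} (hk : Even k) (m : ℕ) :
    Summable fun n => coeff n (insertionSum k m) := by
  have h := (hasSum_coeff_weightedConv 1 1 summable_coeff_polylog_replicate_two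
    summable_coeff_polylog_replicate_two (k + m)).summable
  rw [← insertionSeries_true_eq_weightedConv] at h
  refine h.of_nonneg_of_le (coeff_insertionSum_nonneg k m) fun n => ?_
  rw [insertionSeries, map_sum]
  refine le_trans ?_ (single_le_sum (a := (k, m)) (fun x _ => ?_) (by simp))
  · rw [if_pos (by simpa using hk), coeff_smul, smul_eq_mul]
    refine le_mul_of_one_le_left (coeff_insertionSum_nonneg k m n) ?_
    norm_num
    exact one_le_mul_of_one_le_of_one_le (one_le_pow₀ one_le_two) (one_le_pow₀ one_le_two)
  · split_ifs
    · rw [coeff_smul]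
      exact smul_nonneg (by positivity) (coeff_insertionSum_nonneg _ _ n)
    · simp

theorem sum_weighted_tsum_coeff_insertionSum (p q : ℝ) (N : ℕ) :
    ∑ x ∈ antidiagonal N, (if Even x.1 then ((2 * p * q) ^ x.1 * (p ^ 2 + q ^ 2) ^ x.2) *
        ∑' n, coeff n (insertionSum x.1 x.2) else 0) =
      Real.pi ^ (2 * N) * ∑ i ∈ antidiagonal N, (p ^ (2 * i.1) / (2 * i.1 + 1).factorial) *
        (q ^ (2 * i.2) / (2 * i.2 + 1).factorial) := by
  have h1 := hasSum_coeff_weightedConv p q summable_coeff_polylog_replicate_two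
    summable_coeff_polylog_replicate_two N
  rw [← insertionSeries_true_eq_weightedConv] at h1
  have h2 : HasSum (fun n => coeff n (insertionSeries (p ^ 2 + q ^ 2) (2 * p * q) True N))
      (∑ x ∈ antidiagonal N, (if Even x.1 then ((2 * p * q) ^ x.1 * (p ^ 2 + q ^ 2) ^ x.2) *
        ∑' n, coeff n (insertionSum x.1 x.2) else 0)) := by
    simp only [insertionSeries, map_sum, iff_true]
    refine hasSum_sum fun x _ => ?_
    split_ifs with hx
    · simp only [coeff_smul, smul_eq_mul]
      exact (summable_coeff_insertionSum hx x.2).hasSum.mul_left _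
    · simp
  rw [h2.unique h1, mul_sum]
  refine sum_congr rfl fun i hi => ?_
  rw [tsum_coeff_polylog_replicate_two, tsum_coeff_polylog_replicate_two,
    ← HasAntidiagonal.mem_antidiagonal.1 hi]
  ring

theorem sum_antidiagonal_two_mul {M : Type*} [AddCommMonoid M] (N : ℕ) (F : ℕ → ℕ → M) :
    ∑ x ∈ antidiagonal (2 * N + 2), F x.1 x.2 =
      ∑ x ∈ antidiagonal (N + 1), F (2 * x.1) (2 * x.2) +
        ∑ x ∈ antidiagonal N, F (2 * x.1 + 1) (2 * x.2 + 1) := by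
  induction N generalizing F with
  | zero => simp [Nat.sum_antidiagonal_succ, add_comm, add_left_comm]
  | succ N ih =>
    rw [show 2 * (N + 1) + 2 = (2 * N + 2) + 1 + 1 by ring, Nat.sum_antidiagonal_succ,
      Nat.sum_antidiagonal_succ, ih fun a b => F (a + 1 + 1) b,
      Nat.sum_antidiagonal_succ (n := N + 1) (f := fun x : ℕ × ℕ => F (2 * x.1) (2 * x.2)),
      Nat.sum_antidiagonal_succ (n := N) (f := fun x : ℕ × ℕ => F (2 * x.1 + 1) (2 * x.2 + 1))]
    simp only [mul_add, mul_one, mul_zero, zero_add, add_assoc, Nat.reduceAdd]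
    rw [add_left_comm (F 1 _)]

theorem add_pow_sub_sub_pow_eq_sum (p q : ℝ) (N : ℕ) :
    (p + q) ^ (2 * N + 2) - (p - q) ^ (2 * N + 2) = 2 * p * q * (2 * N + 2).factorial *
      ∑ i ∈ antidiagonal N, (p ^ (2 * i.1) / (2 * i.1 + 1).factorial) *
        (q ^ (2 * i.2) / (2 * i.2 + 1).factorial) := by
  rw [sub_eq_add_neg p q, (Commute.all p q).add_pow', (Commute.all p (-q)).add_pow',
    ← sum_sub_distrib]
  rw [sum_antidiagonal_two_mul N fun a b => (2 * N + 2).choose a • (p ^ a * q ^ b) -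
    (2 * N + 2).choose a • (p ^ a * (-q) ^ b), sum_eq_zero, zero_add, mul_sum]
  · refine sum_congr rfl fun i hi => ?_
    have hN := HasAntidiagonal.mem_antidiagonal.1 hi
    have hc : ((2 * N + 2).choose (2 * i.1 + 1) : ℝ) =
        (2 * N + 2).factorial / ((2 * i.1 + 1).factorial * (2 * i.2 + 1).factorial) := by
      rw [Nat.cast_choose ℝ (by omega), show 2 * N + 2 - (2 * i.1 + 1) = 2 * i.2 + 1 by omega]
    rw [nsmul_eq_mul, nsmul_eq_mul, hc, Odd.neg_pow ⟨i.2, rfl⟩]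
    field_simp
    ring
  · intro i _
    rw [Even.neg_pow (even_two_mul _), sub_self]

theorem sum_pow_mul_tsum_coeff_insertionSum {v : ℝ} (hv0 : 0 ≤ v) (hv1 : v ≤ 1) (N : ℕ) :
    ∑ x ∈ antidiagonal N,
        (if Even x.1 then v ^ (x.1 + 1) * ∑' n, coeff n (insertionSum x.1 x.2) else 0) =
      Real.pi ^ (2 * N) / (2 * N + 2).factorial * ((1 + v) ^ (N + 1) - (1 - v) ^ (N + 1)) := by
  have ha : √(1 + v) ^ 2 = 1 + v := Real.sq_sqrt (by linarith)
  have hb : √(1 - v) ^ 2 = 1 - v := Real.sq_sqrt (by linarith)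
  set p := (√(1 + v) + √(1 - v)) / 2 with hp
  set q := (√(1 + v) - √(1 - v)) / 2 with hq
  have hu : p ^ 2 + q ^ 2 = 1 := by rw [hp, hq]; linear_combination (ha + hb) / 2
  have hpq : 2 * p * q = v := by rw [hp, hq]; linear_combination (ha - hb) / 2
  have h := sum_weighted_tsum_coeff_insertionSum p q N
  have h' := add_pow_sub_sub_pow_eq_sum p q N
  rw [show p + q = √(1 + v) by rw [hp, hq]; ring, show p - q = √(1 - v) by rw [hp, hq]; ring,
    show 2 * N + 2 = 2 * (N + 1) by ring, pow_mul, pow_mul, ha, hb, hpq] at h'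
  rw [hu, hpq] at h
  have hfac : ((2 * (N + 1)).factorial : ℝ) ≠ 0 := by positivity
  trans v * (Real.pi ^ (2 * N) * ∑ i ∈ antidiagonal N, (p ^ (2 * i.1) / (2 * i.1 + 1).factorial) *
        (q ^ (2 * i.2) / (2 * i.2 + 1).factorial))
  · rw [← h, mul_sum]
    refine sum_congr rfl fun x _ => ?_
    rw [one_pow, mul_ite, mul_zero, pow_succ]
    congr 1
    ring
  · rw [show 2 * N + 2 = 2 * (N + 1) by ring, h']
    field_simp

theorem tsum_coeff_insertionSum {k : ℕ} (hk : Even k) (m : ℕ) :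
    ∑' n, coeff n (insertionSum k m) =
      Real.pi ^ (2 * (k + m)) / (2 * (k + m) + 2).factorial *
        (2 * (k + m + 1).choose (k + 1)) := by
  set N := k + m with hN
  have hpoly : (∑ x ∈ antidiagonal N, (if Even x.1 then
      Polynomial.monomial (x.1 + 1) (∑' n, coeff n (insertionSum x.1 x.2)) else 0)) =
      Polynomial.C (Real.pi ^ (2 * N) / ((2 * N + 2).factorial : ℝ)) *
        ((1 + Polynomial.X) ^ (N + 1) -
          ((1 + Polynomial.X) ^ (N + 1)).comp (Polynomial.C (-1) * Polynomial.X)) := by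
    refine Polynomial.eq_of_infinite_eval_eq _ _
      ((Set.Icc_infinite zero_lt_one).mono fun v hv => ?_)
    have h := sum_pow_mul_tsum_coeff_insertionSum hv.1 hv.2 N
    simp only [Set.mem_ofPred_eq, Polynomial.eval_finsetSum, apply_ite (Polynomial.eval v),
      Polynomial.eval_monomial, Polynomial.eval_zero]
    simpa [mul_comm, sub_eq_add_neg] using h
  have h := congrArg (fun P => P.coeff (k + 1)) hpoly
  simp only [Polynomial.finsetSum_coeff, Polynomial.coeff_C_mul, Polynomial.coeff_sub,
    Polynomial.comp_C_mul_X_coeff, Polynomial.coeff_one_add_X_pow] at h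
  rw [sum_eq_single_of_mem (k, m) (by simp [hN])] at h
  · rw [if_pos hk, Polynomial.coeff_monomial, if_pos rfl, hk.add_one.neg_one_pow] at h
    rw [h]
    ring
  · intro x hx hne
    have hxk : x.1 ≠ k := by
      rintro rfl
      refine hne (Prod.ext rfl ?_)
      have := HasAntidiagonal.mem_antidiagonal.1 hx
      simp only
      omega
    split_ifs
    · rw [Polynomial.coeff_monomial, if_neg (by simpa using hxk)]
    · rfl

end

/-- **Bowman–Bradley.** With `wt = 4n + 2m`, the sum of `Z(j₀, …, j_{2n})` over all tuples
of nonnegative integers with `j₀ + ⋯ + j_{2n} = m` equals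
`(1/(2n+1)) · C(m+2n, m) · π^wt / (wt+1)!`. -/
theorem bowman_bradley (n m : ℕ) :
    ∑ j ∈ Finset.Nat.antidiagonalTuple (2 * n + 1) m, Z (List.ofFn j)
      = (1 / (2 * n + 1 : ℝ)) * (Nat.choose (m + 2 * n) m : ℝ)
          * Real.pi ^ (4 * n + 2 * m) / (Nat.factorial (4 * n + 2 * m + 1) : ℝ) := by
  rw [sum_MZV_eq_sum_tsum]
  have hsum := summable_coeff_insertionSum (even_two_mul n) m
  rw [← Summable.tsum_finsetSum]
  · have h := tsum_coeff_insertionSum (even_two_mul n) m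
    simp only [insertionSum, map_sum] at h
    rw [h]
    have hc : ((2 * n + m + 1 : ℕ) : ℝ) * (2 * n + m).choose (2 * n) =
        (2 * n + m + 1).choose (2 * n + 1) * (2 * n + 1 : ℕ) := by
      exact_mod_cast Nat.add_one_mul_choose_eq (2 * n + m) (2 * n)
    rw [show 4 * n + 2 * m = 2 * (2 * n + m) by ring, Nat.add_comm m, ← Nat.choose_symm_add,
      Nat.factorial_succ (2 * (2 * n + m) + 1)]
    push_cast at hc ⊢
    have hfac : ((2 * (2 * n + m) + 1).factorial : ℝ) ≠ 0 := by positivity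
    field_simp
    linear_combination (-2 : ℝ) * hc
  · intro j hj
    refine hsum.of_nonneg_of_le (coeff_polylog_nonneg _) fun N => ?_
    rw [insertionSum, map_sum]
    exact Finset.single_le_sum
      (f := fun j => PowerSeries.coeff N (polylog (outerArgs (List.ofFn j))))
      (fun j _ => coeff_polylog_nonneg _ N) hj
end

section
/- Let α = (b; s, l, t, m) be an odd encoding, and let φ(α) = (c; s, m, t, l) where c is obtained from b by reversing the segment (b_s, b_{s+1}, …, b_t). Then: (i) (s, m, t, l) is an odd encoding on c, that is, s < t, s ≢ t (mod 2), m ≢ l (mod 2), m < 2(c_s + 1) and l < 2(c_t + 1); (ii) the tuple c is a permutation (rearrangement) of the tuple b; and (iii) the subsequence determined by φ(α) has the same length as the subsequence determined by α, namely ∑_{i=s}^{t} 2(b_i + 1) − l − m. -/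
/-- The alternating binary string of length `2 * (bi + 1)`, beginning with `0` if `i` is even
and with `1` if `i` is odd: `(01)^{bi+1}` for even `i` and `(10)^{bi+1}` for odd `i`. -/
def altBlock (i bi : ℕ) : List ℕ :=
  (List.replicate (bi + 1) (if Even i then [0, 1] else [1, 0])).flatten

/-- The word `W(b) = B₀(b) B₁(b) ⋯ B_{2n}(b)`. -/
def word (n : ℕ) (b : ℕ → ℕ) : List ℕ :=
  ((List.range (2 * n + 1)).map fun i => altBlock i (b i)).flatten

/-- The concatenation `B_s(b) B_{s+1}(b) ⋯ B_t(b)`. -/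
def blockSeg (b : ℕ → ℕ) (s t : ℕ) : List ℕ :=
  ((List.range (t + 1 - s)).map fun i => altBlock (s + i) (b (s + i))).flatten

/-- The subsequence determined by the encoding `(s, l, t, m)` on `b`: the string obtained
from `B_s(b) ⋯ B_t(b)` by deleting the first `l` symbols and the last `m` symbols. -/
def subseq (b : ℕ → ℕ) (s l t m : ℕ) : List ℕ :=
  ((blockSeg b s t).drop l).take ((blockSeg b s t).length - l - m)

/-- Reverse the segment of `b` from position `s` to position `t` (inclusive),
leaving all other entries unchanged. -/
def phiVec (b : ℕ → ℕ) (s t : ℕ) : ℕ → ℕ :=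
  fun i => if s ≤ i ∧ i ≤ t then b (s + t - i) else b i

/-- The map `φ : (b; s, l, t, m) ↦ (c; s, m, t, l)`, where `c` is obtained from `b`
by reversing the segment `(b_s, …, b_t)`. -/
def phi (x : (ℕ → ℕ) × ℕ × ℕ × ℕ × ℕ) : (ℕ → ℕ) × ℕ × ℕ × ℕ × ℕ :=
  (phiVec x.1 x.2.1 x.2.2.2.1, x.2.1, x.2.2.2.2, x.2.2.2.1, x.2.2.1)

/-- The quotient sequence of the encoding `(s, l, t, m)` (with `s < t`) on the word `W(b)`
with `2n + 1` blocks: `B₀(b) ⋯ B_{s-1}(b)`, then the first `l + 1` symbols of `B_s(b)`,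
then the last `m + 1` symbols of `B_t(b)`, then `B_{t+1}(b) ⋯ B_{2n}(b)`. -/
def quotSeq (n : ℕ) (b : ℕ → ℕ) (s l t m : ℕ) : List ℕ :=
  ((List.range s).map fun i => altBlock i (b i)).flatten
    ++ (altBlock s (b s)).take (l + 1)
    ++ (altBlock t (b t)).drop ((altBlock t (b t)).length - (m + 1))
    ++ ((List.range (2 * n + 1 - (t + 1))).map fun i =>
          altBlock (t + 1 + i) (b (t + 1 + i))).flatten

/-- The reflection of the interval `[s, t]`, fixing every index outside it. -/
def segReflect (s t i : ℕ) : ℕ :=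
  if s ≤ i ∧ i ≤ t then s + t - i else i

theorem segReflect_involutive (s t : ℕ) : Function.Involutive (segReflect s t) := by
  intro i
  unfold segReflect
  split_ifs <;> omega

theorem segReflect_lt {s t i N : ℕ} (ht : t < N) (hi : i < N) : segReflect s t i < N := by
  unfold segReflect
  split_ifs <;> omega

theorem phiVec_eq_comp_segReflect (b : ℕ → ℕ) (s t : ℕ) :
    phiVec b s t = b ∘ segReflect s t := by
  funext i
  simp only [phiVec, segReflect, Function.comp_apply]
  split_ifs <;> rfl

theorem map_segReflect_range_perm {s t N : ℕ} (ht : t < N) :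
    ((List.range N).map (segReflect s t)).Perm (List.range N) := by
  rw [List.perm_ext_iff_of_nodup
    (List.nodup_range.map (segReflect_involutive s t).injective) List.nodup_range]
  intro i
  simp only [List.mem_map, List.mem_range]
  constructor
  · rintro ⟨j, hj, rfl⟩
    exact segReflect_lt ht hj
  · exact fun hi => ⟨_, segReflect_lt ht hi, segReflect_involutive s t i⟩

theorem map_phiVec_range_perm (b : ℕ → ℕ) {s t N : ℕ} (ht : t < N) :
    ((List.range N).map (phiVec b s t)).Perm ((List.range N).map b) := by
  rw [phiVec_eq_comp_segReflect, ← List.map_map]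
  exact (map_segReflect_range_perm ht).map b

theorem length_altBlock (i k : ℕ) : (altBlock i k).length = 2 * (k + 1) := by
  unfold altBlock
  split_ifs <;> simp [mul_comm]

theorem length_blockSeg (b : ℕ → ℕ) (s t : ℕ) :
    (blockSeg b s t).length = ∑ i ∈ Finset.Icc s t, 2 * (b i + 1) := by
  have hIcc : Finset.Icc s t = Finset.Ico s (t + 1) := by
    ext i
    simp only [Finset.mem_Icc, Finset.mem_Ico]
    omega
  rw [hIcc, Finset.sum_Ico_eq_sum_range]
  simp [blockSeg, List.length_flatten, Function.comp_def, length_altBlock]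
  rfl

theorem length_subseq (b : ℕ → ℕ) (s l t m : ℕ) :
    (subseq b s l t m).length = (∑ i ∈ Finset.Icc s t, 2 * (b i + 1)) - l - m := by
  simp only [subseq, List.length_take, List.length_drop, length_blockSeg]
  omega

theorem sum_phiVec_Icc (b : ℕ → ℕ) (s t : ℕ) :
    ∑ i ∈ Finset.Icc s t, 2 * (phiVec b s t i + 1) = ∑ i ∈ Finset.Icc s t, 2 * (b i + 1) := by
  refine Finset.sum_nbij' (fun i => s + t - i) (fun i => s + t - i) ?_ ?_ ?_ ?_ ?_ <;>
    intro i hi <;> rw [Finset.mem_Icc] at hi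
  · rw [Finset.mem_Icc]
    omega
  · rw [Finset.mem_Icc]
    omega
  · omega
  · omega
  · simp [phiVec, hi]

/-- For an odd encoding `α = (b; s, l, t, m)` and `φ(α) = (c; s, m, t, l)` with
`c = phiVec b s t`: (i) `(s, m, t, l)` is an odd encoding on `c`; (ii) `c` is a
rearrangement of `b` (as tuples indexed by `0, …, 2n`); (iii) the subsequence of `φ(α)`
has the same length as that of `α`, namely `∑_{i=s}^{t} 2(b_i + 1) - l - m`. -/
theorem phi_odd_encoding (n : ℕ) (b : ℕ → ℕ) (s l t m : ℕ)
    (hst : s < t) (ht : t ≤ 2 * n)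
    (hl : l < 2 * (b s + 1)) (hm : m < 2 * (b t + 1))
    (hpar : ¬ s % 2 = t % 2) (hlm : ¬ l % 2 = m % 2) :
    (s < t ∧ ¬ s % 2 = t % 2 ∧ ¬ m % 2 = l % 2 ∧
        m < 2 * (phiVec b s t s + 1) ∧ l < 2 * (phiVec b s t t + 1)) ∧
    ((List.range (2 * n + 1)).map (phiVec b s t)).Perm
        ((List.range (2 * n + 1)).map b) ∧
    (subseq (phiVec b s t) s m t l).length = (subseq b s l t m).length ∧
    (subseq (phiVec b s t) s m t l).length
        = (∑ i ∈ Finset.Icc s t, 2 * (b i + 1)) - l - m := by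
  have hs : phiVec b s t s = b t := by simp [phiVec, hst.le]
  have ht' : phiVec b s t t = b s := by simp [phiVec, hst.le]
  have hlen : (subseq (phiVec b s t) s m t l).length
      = (∑ i ∈ Finset.Icc s t, 2 * (b i + 1)) - l - m := by
    rw [length_subseq, sum_phiVec_Icc]
    omega
  refine ⟨⟨hst, hpar, fun h => hlm h.symm, ?_, ?_⟩, map_phiVec_range_perm b (by omega), ?_, hlen⟩
  · rwa [hs]
  · rwa [ht']
  · rw [hlen, length_subseq]
end

section
/- Let α = (b; s, l, t, m) be an odd encoding and let φ(α) = (c; s, m, t, l), where c is obtained from b by reversing the segment (b_s, …, b_t). Then the subsequence determined by φ(α) (on the word built from c) is the reverse of the subsequence determined by α (on the word built from b). -/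
theorem altBlock_reverse {i j : ℕ} (h : ¬ i % 2 = j % 2) (k : ℕ) :
    (altBlock i k).reverse = altBlock j k := by
  unfold altBlock
  rw [List.reverse_flatten, List.map_replicate, List.reverse_replicate]
  congr 2
  by_cases hi : Even i
  · have hj : ¬ Even j := by grind
    simp [hi, hj]
  · have hj : Even j := by grind
    simp [hi, hj]

theorem blockSeg_phiVec (b : ℕ → ℕ) {s t : ℕ} (hpar : ¬ s % 2 = t % 2) :
    blockSeg (phiVec b s t) s t = (blockSeg b s t).reverse := by
  unfold blockSeg
  rw [List.reverse_flatten]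
  congr 1
  apply List.ext_getElem
  · simp
  · intro j hj _
    have hj' : j < t + 1 - s := by simpa using hj
    simp only [List.getElem_reverse, List.getElem_map, List.getElem_range, List.length_map,
      List.length_range]
    have hidx : s + (t + 1 - s - 1 - j) = t - j := by omega
    rw [hidx, altBlock_reverse (j := s + j) (by omega)]
    have hsub : s + t - (s + j) = t - j := by omega
    simp only [phiVec, hsub]
    rw [if_pos (by omega)]

theorem List.take_drop_reverse {α : Type*} (x : List α) (l m : ℕ) :
    (x.reverse.drop m).take (x.length - m - l) =
      ((x.drop l).take (x.length - l - m)).reverse := by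
  apply List.ext_getElem
  · simp only [List.length_take, List.length_drop, List.length_reverse]
    omega
  · intro i h₁ h₂
    simp only [List.length_take, List.length_drop, List.length_reverse] at h₁ h₂
    simp only [List.getElem_take, List.getElem_drop, List.getElem_reverse, List.length_take,
      List.length_drop]
    congr 1
    omega

/-- For an odd encoding `α = (b; s, l, t, m)` and `φ(α) = (c; s, m, t, l)` with
`c = phiVec b s t`, the subsequence determined by `φ(α)` is the reverse of the
subsequence determined by `α`. -/
theorem phi_subseq_reverse (n : ℕ) (b : ℕ → ℕ) (s l t m : ℕ)
    (hst : s < t) (ht : t ≤ 2 * n)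
    (hl : l < 2 * (b s + 1)) (hm : m < 2 * (b t + 1))
    (hpar : ¬ s % 2 = t % 2) (hlm : ¬ l % 2 = m % 2) :
    subseq (phiVec b s t) s m t l = (subseq b s l t m).reverse := by
  rw [subseq, subseq, blockSeg_phiVec b hpar, List.length_reverse]
  exact List.take_drop_reverse _ l m
end

section
/- Let α = (b; s, l, t, m) be an odd encoding and let φ(α) = (c; s, m, t, l), where c is obtained from b by reversing the segment (b_s, …, b_t). Then the quotient sequence determined by φ(α) (on the word built from c) is equal to the quotient sequence determined by α (on the word built from b). -/
theorem altBlock_eq_map_range (i k : ℕ) :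
    altBlock i k = (List.range (2 * (k + 1))).map fun j => (i + j) % 2 := by
  unfold altBlock
  induction k with
  | zero =>
    rcases Nat.even_or_odd i with h | h
    · have := Nat.even_iff.mp h
      simp [h, List.range_succ]
      omega
    · have := Nat.odd_iff.mp h
      simp [Nat.not_even_iff_odd.mpr h, List.range_succ]
      omega
  | succ k ih =>
    rw [List.replicate_succ', List.flatten_append, ih,
      show 2 * (k + 1 + 1) = 2 * (k + 1) + 1 + 1 by ring, List.range_succ, List.range_succ]
    rcases Nat.even_or_odd i with h | h
    · have := Nat.even_iff.mp h
      simp [h]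
      omega
    · have := Nat.odd_iff.mp h
      simp [Nat.not_even_iff_odd.mpr h]
      omega

/-- For an odd encoding, the two truncated end blocks join to an alternating string. -/
theorem take_altBlock_append_drop_altBlock {s t p q l m : ℕ}
    (hl : l < 2 * (p + 1)) (hm : m < 2 * (q + 1))
    (hpar : ¬ s % 2 = t % 2) (hlm : ¬ l % 2 = m % 2) :
    (altBlock s p).take (l + 1) ++ (altBlock t q).drop ((altBlock t q).length - (m + 1)) =
      (List.range (l + m + 2)).map fun j => (s + j) % 2 := by
  rw [length_altBlock, altBlock_eq_map_range, altBlock_eq_map_range]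
  apply List.ext_getElem
  · simp
    omega
  · intro j h₁ h₂
    simp only [List.getElem_append, List.getElem_take, List.getElem_drop, List.getElem_map,
      List.getElem_range, List.length_take, List.length_map, List.length_range]
    split_ifs <;> omega

/-- For an odd encoding `α = (b; s, l, t, m)` and `φ(α) = (c; s, m, t, l)` with
`c = phiVec b s t`, the quotient sequence determined by `φ(α)` equals the quotient
sequence determined by `α`. -/
theorem phi_quotSeq_eq (n : ℕ) (b : ℕ → ℕ) (s l t m : ℕ)
    (hst : s < t) (ht : t ≤ 2 * n)
    (hl : l < 2 * (b s + 1)) (hm : m < 2 * (b t + 1))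
    (hpar : ¬ s % 2 = t % 2) (hlm : ¬ l % 2 = m % 2) :
    quotSeq n (phiVec b s t) s m t l = quotSeq n b s l t m := by
  have hs : phiVec b s t s = b t := by simp [phiVec, hst.le]
  have ht' : phiVec b s t t = b s := by simp [phiVec, hst.le]
  have hpre : ((List.range s).map fun i => altBlock i (phiVec b s t i)) =
      (List.range s).map fun i => altBlock i (b i) := by
    refine List.map_congr_left fun i hi => ?_
    have := List.mem_range.mp hi
    rw [phiVec, if_neg (by omega)]
  have hsuf (i : ℕ) : phiVec b s t (t + 1 + i) = b (t + 1 + i) := by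
    rw [phiVec, if_neg (by omega)]
  unfold quotSeq
  simp only [hs, ht', hpre, hsuf]
  rw [List.append_assoc (List.flatten _) (List.take (m + 1) _),
    List.append_assoc (List.flatten _) (List.take (l + 1) _),
    take_altBlock_append_drop_altBlock hm hl hpar (Ne.symm hlm),
    take_altBlock_append_drop_altBlock hl hm hpar hlm, Nat.add_comm m l]
end

section
/- Let α = (b; s, l, t, m) be an odd encoding on the tuple b = (b_0, …, b_{2n}). Then the quotient sequence of α equals the concatenation of: the blocks B_0(b) ⋯ B_{s−1}(b), followed by the alternating binary string of length l + m + 2 whose first symbol is the first symbol of B_s(b) (namely 0 if s is even and 1 if s is odd), followed by the blocks B_{t+1}(b) ⋯ B_{2n}(b). -/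
theorem altBlock_take_append_altBlock_drop {s t k r l m : ℕ}
    (hl : l < 2 * (k + 1)) (hm : m < 2 * (r + 1))
    (hpar : ¬ s % 2 = t % 2) (hlm : ¬ l % 2 = m % 2) :
    (altBlock s k).take (l + 1)
        ++ (altBlock t r).drop ((altBlock t r).length - (m + 1))
      = (List.range (l + m + 2)).map fun i => (s + i) % 2 := by
  rw [length_altBlock, altBlock_eq_map_range, altBlock_eq_map_range]
  apply List.ext_getElem
  · simp
    omega
  · intro i h₁ h₂
    simp only [List.getElem_append, List.getElem_take, List.getElem_drop, List.getElem_map,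
      List.getElem_range, List.length_take, List.length_map, List.length_range]
    split_ifs <;> omega

/-- For an odd encoding `α = (b; s, l, t, m)`, the quotient sequence of `α` equals
`B₀(b) ⋯ B_{s-1}(b)`, followed by the alternating binary string of length `l + m + 2`
whose first symbol is the first symbol of `B_s(b)` (i.e. `0` if `s` is even, `1` if `s`
is odd), followed by `B_{t+1}(b) ⋯ B_{2n}(b)`. -/
theorem quotSeq_alternating (n : ℕ) (b : ℕ → ℕ) (s l t m : ℕ)
    (hst : s < t) (ht : t ≤ 2 * n)
    (hl : l < 2 * (b s + 1)) (hm : m < 2 * (b t + 1))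
    (hpar : ¬ s % 2 = t % 2) (hlm : ¬ l % 2 = m % 2) :
    quotSeq n b s l t m
      = ((List.range s).map fun i => altBlock i (b i)).flatten
          ++ (List.range (l + m + 2)).map (fun i => (s + i) % 2)
          ++ ((List.range (2 * n + 1 - (t + 1))).map fun i =>
                altBlock (t + 1 + i) (b (t + 1 + i))).flatten := by
  rw [quotSeq, List.append_assoc (List.flatten _),
    altBlock_take_append_altBlock_drop hl hm hpar hlm]
end
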